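/- Truncation perturbs Lipschitz linear spectral statistics only sub-exponentially: There exist C₁, C₂ > 0 such that for every Lipschitz function f: ℝ → ℝ with Lipschitz constant ||f||_L and uniformly over y ∈ ℝ^m, E_z| Tr f(H_n^Λ(y)) − Tr f(H̃_n^Λ(y)) | ≤ C₁ ||f||_L n^{3/2} exp(−C₂ n^γ). -/

import Mathlib

/- STATEMENT 11: truncation of the Gaussian entries perturbs Lipschitz linear spectral
statistics only sub-exponentially (Proposition A.8 of the paper): there are C₁, C₂ > 0
such that for every Lipschitz f with constant ‖f‖_L, uniformly over y ∈ ℝ^m,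
  E_z |Tr f(H_n^Λ(y)) − Tr f(H̃_n^Λ(y))| ≤ C₁ ‖f‖_L n^{3/2} e^{−C₂ n^γ}. -/


open MeasureTheory Matrix Filter Topology Real Set ProbabilityTheory
open scoped ENNReal NNReal Classical

noncomputable section

abbrev stdGauss : Measure ℝ := gaussianReal 0 1

def gaussVec (k : ℕ) : Measure (Fin k → ℝ) := Measure.pi fun _ => stdGauss

def gaussMat (a b : ℕ) : Measure (Fin a → Fin b → ℝ) :=
  Measure.pi fun _ => Measure.pi fun _ => stdGauss

def Pperp (φ : ℝ → ℝ) {m : ℕ} (y : Fin m → ℝ) : Matrix (Fin m) (Fin m) ℝ :=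
  1 - Matrix.of (fun μ ν => deriv φ (y μ) * deriv φ (y ν) / ∑ ρ, (deriv φ (y ρ)) ^ 2)

def Dmat (φ : ℝ → ℝ) (n : ℕ) {m : ℕ} (y : Fin m → ℝ) : Matrix (Fin m) (Fin m) ℝ :=
  Matrix.diagonal fun μ => ((n : ℝ) / m) * deriv (deriv φ) (y μ)

def Lam (φ : ℝ → ℝ) (n : ℕ) {m : ℕ} (y : Fin m → ℝ) : Matrix (Fin m) (Fin m) ℝ :=
  Pperp φ y * Dmat φ n y * Pperp φ y

def Hmat (φ : ℝ → ℝ) (n : ℕ) {m : ℕ} (y : Fin m → ℝ)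
    (z : Fin (n - 1) → Fin m → ℝ) : Matrix (Fin (n - 1)) (Fin (n - 1)) ℝ :=
  ((n : ℝ)⁻¹) • (Matrix.of z * Lam φ n y * (Matrix.of z)ᵀ) -
    ((1 / (m : ℝ)) * ∑ μ, y μ * deriv φ (y μ)) • 1

/-- `E_z |det H_n^Λ(y)|`. -/
def Edet (φ : ℝ → ℝ) (n m : ℕ) (y : Fin m → ℝ) : ℝ :=
  ∫ z, |Matrix.det (Hmat φ n y z)| ∂(gaussMat (n - 1) m)


/-- Eigenvalues of a (Hermitian) real matrix; junk value `0` otherwise. -/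
def eigs {k : ℕ} (M : Matrix (Fin k) (Fin k) ℝ) : Fin k → ℝ :=
  if h : M.IsHermitian then h.eigenvalues else 0

/-- `Tr f(M) = ∑_i f(λ_i(M))`. -/
def trF {k : ℕ} (f : ℝ → ℝ) (M : Matrix (Fin k) (Fin k) ℝ) : ℝ :=
  ∑ i, f (eigs M i)

/-- The truncation normalizer `E[z² 1{|z| ≤ c}]`. -/
def truncNorm (c : ℝ) : ℝ := ∫ x in {x : ℝ | |x| ≤ c}, x ^ 2 ∂stdGauss

/-- Truncated and renormalized entry `z̃ = z 1{|z| ≤ c} / (E[z² 1{|z| ≤ c}])^{1/2}`. -/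
def trunc (c v : ℝ) : ℝ := (if |v| ≤ c then v else 0) / Real.sqrt (truncNorm c)

/-- The eigenvalues of two symmetric matrices are intertwined by a doubly stochastic matrix, which
controls the difference of Lipschitz linear statistics by the entries of the difference. -/
theorem abs_trF_sub_le {k : ℕ} {A B : Matrix (Fin k) (Fin k) ℝ} (hA : A.IsHermitian)
    (hB : B.IsHermitian) {K : ℝ≥0} {f : ℝ → ℝ} (hf : LipschitzWith K f) :
    |trF f A - trF f B| ≤ K * (k : ℝ) ^ 2 * ∑ i, ∑ j, |A i j - B i j| := by
  set U : Matrix (Fin k) (Fin k) ℝ := (hA.eigenvectorUnitary : Matrix (Fin k) (Fin k) ℝ) with hU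
  set V : Matrix (Fin k) (Fin k) ℝ := (hB.eigenvectorUnitary : Matrix (Fin k) (Fin k) ℝ) with hV
  set a := hA.eigenvalues with ha
  set b := hB.eigenvalues with hb
  have hUm : U ∈ Matrix.unitaryGroup (Fin k) ℝ := hA.eigenvectorUnitary.2
  have hVm : V ∈ Matrix.unitaryGroup (Fin k) ℝ := hB.eigenvectorUnitary.2
  have hUU : star U * U = 1 := Unitary.coe_star_mul_self hA.eigenvectorUnitary
  have hVV : star V * V = 1 := Unitary.coe_star_mul_self hB.eigenvectorUnitary
  have hAs : A = U * diagonal a * star U := by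
    conv_lhs => rw [hA.spectral_theorem, Unitary.conjStarAlgAut_apply]
    rfl
  have hBs : B = V * diagonal b * star V := by
    conv_lhs => rw [hB.spectral_theorem, Unitary.conjStarAlgAut_apply]
    rfl
  set W := star U * V with hW
  have hWm : W ∈ Matrix.unitaryGroup (Fin k) ℝ := mul_mem (Unitary.star_mem hUm) hVm
  have hrow : ∀ i, ∑ j, W i j ^ 2 = 1 := by
    intro i
    have h := congrFun (congrFun (Matrix.mem_unitaryGroup_iff.1 hWm) i) i
    simpa [Matrix.mul_apply, Matrix.star_apply, sq] using h
  have hcol : ∀ j, ∑ i, W i j ^ 2 = 1 := by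
    intro j
    have h := congrFun (congrFun (Matrix.mem_unitaryGroup_iff'.1 hWm) j) j
    simpa [Matrix.mul_apply, Matrix.star_apply, sq] using h
  have hE : ∀ i j, (a i - b j) * W i j = (star U * (A - B) * V) i j := by
    have h : star U * (A - B) * V = diagonal a * W - W * diagonal b := by
      have h1 : star U * A * V = diagonal a * W := by
        conv_lhs => rw [hAs]
        calc star U * (U * diagonal a * star U) * V
            = (star U * U) * diagonal a * (star U * V) := by simp only [Matrix.mul_assoc]
          _ = _ := by rw [hUU, Matrix.one_mul]
      have h2 : star U * B * V = W * diagonal b := by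
        conv_lhs => rw [hBs]
        calc star U * (V * diagonal b * star V) * V
            = (star U * V) * diagonal b * (star V * V) := by simp only [Matrix.mul_assoc]
          _ = _ := by rw [hVV, Matrix.mul_one]
      rw [Matrix.mul_sub, Matrix.sub_mul, h1, h2]
    intro i j
    rw [h, Matrix.sub_apply, Matrix.diagonal_mul, Matrix.mul_diagonal]
    ring
  have hEle : ∀ i j, |(star U * (A - B) * V) i j| ≤ ∑ p, ∑ q, |A p q - B p q| := by
    intro i j
    have hent : (star U * (A - B) * V) i j = ∑ q, ∑ p, U p i * (A p q - B p q) * V q j := by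
      simp [Matrix.mul_apply, Matrix.star_apply, Finset.sum_mul]
    rw [hent, Finset.sum_comm]
    refine (Finset.abs_sum_le_sum_abs _ _).trans (Finset.sum_le_sum fun p _ => ?_)
    refine (Finset.abs_sum_le_sum_abs _ _).trans (Finset.sum_le_sum fun q _ => ?_)
    have h1 : |U p i| ≤ 1 := entry_norm_bound_of_unitary hUm p i
    have h2 : |V q j| ≤ 1 := entry_norm_bound_of_unitary hVm q j
    rw [abs_mul, abs_mul]
    calc |U p i| * |A p q - B p q| * |V q j| ≤ 1 * |A p q - B p q| * 1 := by gcongr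
      _ = _ := by ring
  have hdiff : trF f A - trF f B = ∑ i, ∑ j, (f (a i) - f (b j)) * W i j ^ 2 := by
    have h1 : trF f A = ∑ i, ∑ j, f (a i) * W i j ^ 2 := by
      simp only [← Finset.mul_sum, hrow, mul_one, trF, eigs, dif_pos hA, ha]
    have h2 : trF f B = ∑ i, ∑ j, f (b j) * W i j ^ 2 := by
      rw [Finset.sum_comm]
      simp only [← Finset.mul_sum, hcol, mul_one, trF, eigs, dif_pos hB, hb]
    rw [h1, h2]
    simp only [← Finset.sum_sub_distrib, sub_mul]
  rw [hdiff]
  have hterm : ∀ i j, |(f (a i) - f (b j)) * W i j ^ 2| ≤ K * ∑ p, ∑ q, |A p q - B p q| := by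
    intro i j
    have hl : |f (a i) - f (b j)| ≤ K * |a i - b j| := by
      simpa [Real.dist_eq] using hf.dist_le_mul (a i) (b j)
    have hw : |W i j| ≤ 1 := entry_norm_bound_of_unitary hWm i j
    calc |(f (a i) - f (b j)) * W i j ^ 2|
        = |f (a i) - f (b j)| * |W i j| * |W i j| := by rw [abs_mul, abs_pow]; ring
      _ ≤ (K * |a i - b j|) * |W i j| * 1 := by gcongr
      _ = K * |(a i - b j) * W i j| := by rw [abs_mul]; ring
      _ ≤ _ := by rw [hE]; gcongr; exact hEle i j
  calc |∑ i, ∑ j, (f (a i) - f (b j)) * W i j ^ 2|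
      ≤ ∑ i : Fin k, ∑ j : Fin k, K * ∑ p, ∑ q, |A p q - B p q| := by
        refine (Finset.abs_sum_le_sum_abs _ _).trans (Finset.sum_le_sum fun i _ => ?_)
        exact (Finset.abs_sum_le_sum_abs _ _).trans (Finset.sum_le_sum fun j _ => hterm i j)
    _ = _ := by simp; ring

theorem abs_Pperp_le (φ : ℝ → ℝ) {m : ℕ} (y : Fin m → ℝ) (μ ν : Fin m) :
    |Pperp φ y μ ν| ≤ 2 := by
  have hone : |(1 : Matrix (Fin m) (Fin m) ℝ) μ ν| ≤ 1 := by
    rw [Matrix.one_apply]; split_ifs <;> simp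
  set d : Fin m → ℝ := fun ρ => deriv φ (y ρ) with hd
  have hS : ∀ ρ, d ρ ^ 2 ≤ ∑ ρ, d ρ ^ 2 := fun ρ =>
    Finset.single_le_sum (f := fun ρ => d ρ ^ 2) (fun _ _ => sq_nonneg _) (Finset.mem_univ ρ)
  have hS0 : 0 ≤ ∑ ρ, d ρ ^ 2 := Finset.sum_nonneg fun _ _ => sq_nonneg _
  have hq : |d μ * d ν / ∑ ρ, d ρ ^ 2| ≤ 1 := by
    rw [abs_div, abs_of_nonneg hS0]
    refine div_le_one_of_le₀ ?_ hS0
    rw [abs_le]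
    constructor <;> nlinarith [hS μ, hS ν, sq_nonneg (d μ - d ν), sq_nonneg (d μ + d ν)]
  calc |Pperp φ y μ ν|
      = |(1 : Matrix (Fin m) (Fin m) ℝ) μ ν - d μ * d ν / ∑ ρ, d ρ ^ 2| := by
        simp [Pperp, hd]
    _ ≤ 1 + 1 := (abs_sub _ _).trans (add_le_add hone hq)
    _ = 2 := by norm_num

theorem Pperp_transpose (φ : ℝ → ℝ) {m : ℕ} (y : Fin m → ℝ) : (Pperp φ y)ᵀ = Pperp φ y := by
  ext μ ν
  simp [Pperp, Matrix.one_apply, eq_comm, mul_comm]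

theorem Lam_transpose (φ : ℝ → ℝ) (n : ℕ) {m : ℕ} (y : Fin m → ℝ) :
    (Lam φ n y)ᵀ = Lam φ n y := by
  simp [Lam, Dmat, Matrix.transpose_mul, Pperp_transpose, Matrix.mul_assoc]

theorem Hmat_isHermitian (φ : ℝ → ℝ) (n : ℕ) {m : ℕ} (y : Fin m → ℝ)
    (z : Fin (n - 1) → Fin m → ℝ) : (Hmat φ n y z).IsHermitian := by
  rw [Matrix.IsHermitian, Matrix.conjTranspose_eq_transpose_of_trivial]
  simp [Hmat, Matrix.transpose_mul, Lam_transpose, Matrix.mul_assoc]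

theorem abs_Lam_le (φ : ℝ → ℝ) (n : ℕ) {m : ℕ} (y : Fin m → ℝ) {R D : ℝ}
    (hR : (n : ℝ) / m ≤ R) (hD : ∀ x, |deriv (deriv φ) x| ≤ D) (μ ν : Fin m) :
    |Lam φ n y μ ν| ≤ m * (4 * R * D) := by
  have hent : Lam φ n y μ ν
      = ∑ ρ, Pperp φ y μ ρ * ((n : ℝ) / m * deriv (deriv φ) (y ρ)) * Pperp φ y ρ ν := by
    simp [Lam, Dmat, Matrix.mul_apply (M := Pperp φ y * _), Matrix.mul_diagonal]
  have hnm : 0 ≤ (n : ℝ) / m := by positivity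
  rw [hent]
  calc |∑ ρ, Pperp φ y μ ρ * ((n : ℝ) / m * deriv (deriv φ) (y ρ)) * Pperp φ y ρ ν|
      ≤ ∑ _ρ : Fin m, 2 * (R * D) * 2 := by
        refine (Finset.abs_sum_le_sum_abs _ _).trans (Finset.sum_le_sum fun ρ _ => ?_)
        rw [abs_mul, abs_mul, abs_mul, abs_of_nonneg hnm]
        have := abs_Pperp_le φ y μ ρ
        have := abs_Pperp_le φ y ρ ν
        have := hD (y ρ)
        have hR0 : 0 ≤ R := hnm.trans hR
        have hD0 : 0 ≤ D := (abs_nonneg _).trans this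
        gcongr
    _ = m * (4 * R * D) := by
        rw [Finset.sum_const, Finset.card_univ, Fintype.card_fin, nsmul_eq_mul]; ring

/-- Entrywise comparison of the matrices built from two arrays. -/
theorem abs_Hmat_sub_le (φ : ℝ → ℝ) (n : ℕ) {m : ℕ} (y : Fin m → ℝ) {L : ℝ}
    (hL : ∀ μ ν, |Lam φ n y μ ν| ≤ L) (z w : Fin (n - 1) → Fin m → ℝ) (i j : Fin (n - 1)) :
    |Hmat φ n y z i j - Hmat φ n y w i j|
      ≤ (n : ℝ)⁻¹ * ∑ μ, ∑ ν, L * |z i μ * z j ν - w i μ * w j ν| := by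
  have hent : Hmat φ n y z i j - Hmat φ n y w i j
      = (n : ℝ)⁻¹ * ∑ μ, ∑ ν, Lam φ n y μ ν * (z i μ * z j ν - w i μ * w j ν) := by
    have h : ∀ z : Fin (n - 1) → Fin m → ℝ, (Matrix.of z * Lam φ n y * (Matrix.of z)ᵀ) i j
        = ∑ μ, ∑ ν, Lam φ n y μ ν * (z i μ * z j ν) := by
      intro z
      rw [Finset.sum_comm]
      simp only [Matrix.mul_apply, Matrix.of_apply, Matrix.transpose_apply, Finset.sum_mul]
      exact Finset.sum_congr rfl fun _ _ => Finset.sum_congr rfl fun _ _ => by ring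
    simp only [Hmat, Matrix.sub_apply, Matrix.smul_apply, h, smul_eq_mul, mul_sub,
      Finset.sum_sub_distrib]
    ring
  rw [hent, abs_mul, abs_of_nonneg (by positivity : (0 : ℝ) ≤ (n : ℝ)⁻¹)]
  gcongr
  refine (Finset.abs_sum_le_sum_abs _ _).trans (Finset.sum_le_sum fun μ _ => ?_)
  refine (Finset.abs_sum_le_sum_abs _ _).trans (Finset.sum_le_sum fun ν _ => ?_)
  rw [abs_mul]
  gcongr
  exact hL μ ν

theorem measurePreserving_gaussMat_entry {a b : ℕ} (i : Fin a) (μ : Fin b) :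
    MeasurePreserving (fun z : Fin a → Fin b → ℝ => z i μ) (gaussMat a b) stdGauss :=
  (measurePreserving_eval (fun _ : Fin b => stdGauss) μ).comp
    (measurePreserving_eval (fun _ : Fin a => Measure.pi fun _ : Fin b => stdGauss) i)

theorem integrable_gaussMat_entry {a b : ℕ} (i : Fin a) (μ : Fin b) {h : ℝ → ℝ}
    (hh : Integrable h stdGauss) : Integrable (fun z => h (z i μ)) (gaussMat a b) :=
  (measurePreserving_gaussMat_entry i μ).integrable_comp_of_integrable hh

theorem integral_gaussMat_entry {a b : ℕ} (i : Fin a) (μ : Fin b) {h : ℝ → ℝ}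
    (hh : Integrable h stdGauss) : ∫ z, h (z i μ) ∂(gaussMat a b) = ∫ x, h x ∂stdGauss := by
  have hmp := measurePreserving_gaussMat_entry (a := a) (b := b) i μ
  have h1 : AEStronglyMeasurable h ((gaussMat a b).map fun z => z i μ) := by
    rw [hmp.map_eq]; exact hh.1
  rw [← hmp.map_eq, integral_map hmp.measurable.aemeasurable h1]

theorem integrable_sq_stdGauss : Integrable (fun x : ℝ => x ^ 2) stdGauss :=
  (memLp_id_gaussianReal' 2 (by simp)).integrable_sq

theorem integral_sq_stdGauss : ∫ x : ℝ, x ^ 2 ∂stdGauss = 1 := by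
  have h := variance_id_gaussianReal (μ := 0) (v := 1)
  rw [variance_of_integral_eq_zero aemeasurable_id (by simp)] at h
  simpa using h

theorem measurableSet_abs_le (c : ℝ) : MeasurableSet {x : ℝ | |x| ≤ c} :=
  measurableSet_le (by fun_prop) (by fun_prop)

theorem truncNorm_mono {c d : ℝ} (h : c ≤ d) : truncNorm c ≤ truncNorm d :=
  setIntegral_mono_set integrable_sq_stdGauss.integrableOn
    (Eventually.of_forall fun _ => sq_nonneg _)
    (Eventually.of_forall fun _ hx => le_trans hx h)

theorem truncNorm_add_compl (c : ℝ) :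
    truncNorm c + ∫ x in {x : ℝ | |x| ≤ c}ᶜ, x ^ 2 ∂stdGauss = 1 := by
  rw [truncNorm, integral_add_compl (measurableSet_abs_le c) integrable_sq_stdGauss,
    integral_sq_stdGauss]

theorem truncNorm_le_one (c : ℝ) : truncNorm c ≤ 1 := by
  have := truncNorm_add_compl c
  have : 0 ≤ ∫ x in {x : ℝ | |x| ≤ c}ᶜ, x ^ 2 ∂stdGauss := integral_nonneg fun _ => sq_nonneg _
  linarith

theorem truncNorm_one_pos : 0 < truncNorm 1 := by
  rw [truncNorm, setIntegral_pos_iff_support_of_nonneg_ae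
    (Eventually.of_forall fun _ => sq_nonneg _) integrable_sq_stdGauss.integrableOn]
  have hsub : Ioo (0 : ℝ) 1 ⊆ Function.support (fun x : ℝ => x ^ 2) ∩ {x : ℝ | |x| ≤ 1} := by
    intro x hx
    refine ⟨?_, ?_⟩
    · simpa using hx.1.ne'
    · simpa [abs_of_pos hx.1] using hx.2.le
  refine lt_of_lt_of_le (pos_iff_ne_zero.2 fun h0 => ?_) (measure_mono hsub)
  have := gaussianReal_absolutelyContinuous' 0 (one_ne_zero (α := ℝ≥0)) h0
  simp at this

theorem exists_one_sub_truncNorm_le :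
    ∃ M > (0 : ℝ), ∃ a > (0 : ℝ), ∀ c : ℝ, 0 ≤ c →
      1 - truncNorm c ≤ M * Real.exp (-a * c ^ 2) := by
  obtain ⟨C, hC, hInt⟩ := IsGaussian.exists_integrable_exp_sq stdGauss
  simp only [Real.norm_eq_abs, sq_abs] at hInt
  have hInt' := hInt.const_mul (2 / C)
  set I := ∫ x : ℝ, 2 / C * Real.exp (C * x ^ 2) ∂stdGauss
  have hI : 0 ≤ I := integral_nonneg fun x => by positivity
  refine ⟨I + 1, by positivity, C / 2, by positivity, fun c hc => ?_⟩
  have h1 : 1 - truncNorm c = ∫ x in {x : ℝ | |x| ≤ c}ᶜ, x ^ 2 ∂stdGauss := by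
    linarith [truncNorm_add_compl c]
  rw [h1]
  calc ∫ x in {x : ℝ | |x| ≤ c}ᶜ, x ^ 2 ∂stdGauss
      ≤ ∫ x in {x : ℝ | |x| ≤ c}ᶜ,
          2 / C * Real.exp (C * x ^ 2) * Real.exp (-(C / 2) * c ^ 2) ∂stdGauss := by
        refine setIntegral_mono_on integrable_sq_stdGauss.integrableOn
          (hInt'.mul_const _).integrableOn (measurableSet_abs_le c).compl fun x hx => ?_
        have hx' : c ^ 2 ≤ x ^ 2 := by
          rw [← sq_abs x]
          have : c < |x| := by simpa using hx
          gcongr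
        rw [mul_assoc, ← Real.exp_add]
        have h2 : C / 2 * x ^ 2 ≤ Real.exp (C / 2 * x ^ 2) := by
          linarith [Real.add_one_le_exp (C / 2 * x ^ 2)]
        calc x ^ 2 = 2 / C * (C / 2 * x ^ 2) := by field_simp
          _ ≤ 2 / C * Real.exp (C * x ^ 2 + -(C / 2) * c ^ 2) := by
            gcongr
            refine h2.trans (Real.exp_le_exp.2 ?_)
            nlinarith
    _ ≤ ∫ x, 2 / C * Real.exp (C * x ^ 2) * Real.exp (-(C / 2) * c ^ 2) ∂stdGauss :=
        setIntegral_le_integral (hInt'.mul_const _) (Eventually.of_forall fun x => by positivity)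
    _ = I * Real.exp (-(C / 2) * c ^ 2) := integral_mul_const _ _
    _ ≤ _ := by gcongr; linarith

theorem abs_trunc_le {c : ℝ} (hc : 1 ≤ c) (v : ℝ) :
    |trunc c v| ≤ (Real.sqrt (truncNorm 1))⁻¹ * |v| := by
  have h1 : 0 < Real.sqrt (truncNorm 1) := Real.sqrt_pos.2 truncNorm_one_pos
  have h2 : Real.sqrt (truncNorm 1) ≤ Real.sqrt (truncNorm c) :=
    Real.sqrt_le_sqrt (truncNorm_mono hc)
  have h3 : |if |v| ≤ c then v else 0| ≤ |v| := by split_ifs <;> simp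
  rw [trunc, abs_div, abs_of_nonneg (Real.sqrt_nonneg _), div_eq_inv_mul]
  gcongr

theorem measurable_trunc (c : ℝ) : Measurable (trunc c) :=
  (Measurable.ite (measurableSet_abs_le c) measurable_id measurable_const).div_const _

theorem integrable_sub_trunc_sq {c : ℝ} (hc : 1 ≤ c) :
    Integrable (fun x => (x - trunc c x) ^ 2) stdGauss := by
  refine (integrable_sq_stdGauss.const_mul ((1 + (Real.sqrt (truncNorm 1))⁻¹) ^ 2)).mono'
    ((measurable_id.sub (measurable_trunc c)).pow_const 2).aestronglyMeasurable
    (Eventually.of_forall fun x => ?_)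
  have h : |x - trunc c x| ≤ (1 + (Real.sqrt (truncNorm 1))⁻¹) * |x| := by
    linarith [abs_sub x (trunc c x), abs_trunc_le hc x]
  rw [Real.norm_eq_abs, abs_pow, ← sq_abs x, ← mul_pow]
  gcongr

theorem integral_sub_trunc_sq_le {c : ℝ} (hc : 1 ≤ c) :
    ∫ x, (x - trunc c x) ^ 2 ∂stdGauss ≤ 2 * (1 - truncNorm c) := by
  have hT : 0 < truncNorm c := truncNorm_one_pos.trans_le (truncNorm_mono hc)
  have hq : 0 < Real.sqrt (truncNorm c) := Real.sqrt_pos.2 hT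
  have hq2 : Real.sqrt (truncNorm c) ^ 2 = truncNorm c := Real.sq_sqrt hT.le
  have hq1 : Real.sqrt (truncNorm c) ≤ 1 := Real.sqrt_le_one.2 (truncNorm_le_one c)
  have hS := measurableSet_abs_le c
  rw [← integral_add_compl hS (integrable_sub_trunc_sq hc)]
  have h1 : ∫ x in {x : ℝ | |x| ≤ c}, (x - trunc c x) ^ 2 ∂stdGauss
      = (1 - (Real.sqrt (truncNorm c))⁻¹) ^ 2 * truncNorm c := by
    rw [truncNorm, ← integral_const_mul]
    refine setIntegral_congr_fun hS fun x hx => ?_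
    have hx' : |x| ≤ c := hx
    simp only [trunc, if_pos hx', truncNorm]
    ring
  have h2 : ∫ x in {x : ℝ | |x| ≤ c}ᶜ, (x - trunc c x) ^ 2 ∂stdGauss = 1 - truncNorm c := by
    rw [eq_sub_iff_add_eq', ← truncNorm_add_compl c]
    congr 1
    refine setIntegral_congr_fun hS.compl fun x hx => ?_
    have hx' : ¬ |x| ≤ c := hx
    simp [trunc, if_neg hx']
  rw [h1, h2]
  have h3 : (1 - (Real.sqrt (truncNorm c))⁻¹) ^ 2 * truncNorm c
      = (1 - Real.sqrt (truncNorm c)) ^ 2 := by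
    rw [← hq2]
    simp only [Real.sqrt_sq hq.le]
    field_simp
    ring
  rw [h3]
  nlinarith

/-- Weighted arithmetic–geometric bound for the perturbation of a product of two entries. -/
theorem abs_mul_sub_trunc_mul_le {c ε : ℝ} (hc : 1 ≤ c) (hε : 0 < ε) (s t : ℝ) :
    |s * t - trunc c s * trunc c t| ≤ (1 + (Real.sqrt (truncNorm 1))⁻¹) *
      ((ε * s ^ 2 + ε⁻¹ * (s - trunc c s) ^ 2) + (ε * t ^ 2 + ε⁻¹ * (t - trunc c t) ^ 2)) := by
  have hamgm : ∀ a b : ℝ, |a| * |b| ≤ ε * a ^ 2 + ε⁻¹ * b ^ 2 := by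
    intro a b
    have h : ε * a ^ 2 + ε⁻¹ * b ^ 2 - |a| * |b|
        = ε⁻¹ * ((ε * |a| - |b| / 2) ^ 2 + 3 / 4 * b ^ 2) := by
      rw [← sq_abs a, ← sq_abs b]
      field_simp
      ring
    have : 0 ≤ ε⁻¹ * ((ε * |a| - |b| / 2) ^ 2 + 3 / 4 * b ^ 2) := by positivity
    linarith
  set B := (Real.sqrt (truncNorm 1))⁻¹
  have hB : 0 ≤ B := by positivity
  have h1 := hamgm s (t - trunc c t)
  have h2 := hamgm t (s - trunc c s)
  calc |s * t - trunc c s * trunc c t|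
      = |s * (t - trunc c t) + trunc c t * (s - trunc c s)| := by ring_nf
    _ ≤ |s| * |t - trunc c t| + |trunc c t| * |s - trunc c s| := by
        rw [← abs_mul, ← abs_mul]; exact abs_add_le _ _
    _ ≤ |s| * |t - trunc c t| + B * |t| * |s - trunc c s| := by
        gcongr; exact abs_trunc_le hc t
    _ ≤ (1 + B) * (|s| * |t - trunc c t| + |t| * |s - trunc c s|) := by
        have h3 : 0 ≤ |s| * |t - trunc c t| := by positivity
        have h4 : 0 ≤ |t| * |s - trunc c s| := by positivity
        nlinarith [mul_nonneg hB h3]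
    _ ≤ _ := mul_le_mul_of_nonneg_left (by linarith) (by positivity)

theorem integral_abs_trF_sub_trunc_le (φ : ℝ → ℝ) {n m : ℕ} (y : Fin m → ℝ) {L c ε I : ℝ}
    (hL0 : 0 ≤ L) (hL : ∀ μ ν, |Lam φ n y μ ν| ≤ L) (hc : 1 ≤ c) (hε : 0 < ε)
    (hI : ε + ε⁻¹ * ∫ x, (x - trunc c x) ^ 2 ∂stdGauss ≤ I) {K : ℝ≥0} {f : ℝ → ℝ}
    (hf : LipschitzWith K f) :
    ∫ z, |trF f (Hmat φ n y z) - trF f (Hmat φ n y (fun i μ => trunc c (z i μ)))|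
        ∂(gaussMat (n - 1) m)
      ≤ K * ((n - 1 : ℕ) : ℝ) ^ 4 * (n : ℝ)⁻¹ * (m : ℝ) ^ 2 *
        (L * (1 + (Real.sqrt (truncNorm 1))⁻¹) * (2 * I)) := by
  set B := 1 + (Real.sqrt (truncNorm 1))⁻¹
  have hB : 0 ≤ B := by positivity
  set h : ℝ → ℝ := fun s => ε * s ^ 2 + ε⁻¹ * (s - trunc c s) ^ 2 with hh
  have hInt1 := integrable_sq_stdGauss.const_mul ε
  have hInt2 := (integrable_sub_trunc_sq hc).const_mul ε⁻¹
  have hInt : Integrable h stdGauss := hInt1.add hInt2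
  have hhI : ∫ x, h x ∂stdGauss ≤ I := by
    rw [hh, integral_add hInt1 hInt2, integral_const_mul, integral_const_mul,
      integral_sq_stdGauss, mul_one]
    exact hI
  set G : (Fin (n - 1) → Fin m → ℝ) → ℝ := fun z =>
    K * ((n - 1 : ℕ) : ℝ) ^ 2 * ∑ i, ∑ j, (n : ℝ)⁻¹ * ∑ μ, ∑ ν,
      L * (B * (h (z i μ) + h (z j ν))) with hG
  have hterm : ∀ i j μ ν, Integrable
      (fun z : Fin (n - 1) → Fin m → ℝ => L * (B * (h (z i μ) + h (z j ν))))
      (gaussMat (n - 1) m) := fun i j μ ν =>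
    (((integrable_gaussMat_entry i μ hInt).add
      (integrable_gaussMat_entry j ν hInt)).const_mul B).const_mul L
  have hν := fun i j μ => integrable_finsetSum Finset.univ fun ν _ => hterm i j μ ν
  have hμ := fun i j => (integrable_finsetSum Finset.univ fun μ _ => hν i j μ).const_mul (n : ℝ)⁻¹
  have hj := fun i => integrable_finsetSum Finset.univ fun j _ => hμ i j
  have hi := integrable_finsetSum Finset.univ fun i _ => hj i
  have hle : ∀ z, |trF f (Hmat φ n y z) - trF f (Hmat φ n y (fun i μ => trunc c (z i μ)))|
      ≤ G z := by
    intro z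
    refine (abs_trF_sub_le (Hmat_isHermitian φ n y _) (Hmat_isHermitian φ n y _) hf).trans ?_
    simp only [hG]
    gcongr with i _ j _
    refine (abs_Hmat_sub_le φ n y hL _ _ i j).trans ?_
    gcongr with μ _ ν _
    exact abs_mul_sub_trunc_mul_le hc hε _ _
  have hGint : Integrable G (gaussMat (n - 1) m) := hi.const_mul _
  calc ∫ z, |trF f (Hmat φ n y z) - trF f (Hmat φ n y (fun i μ => trunc c (z i μ)))|
        ∂(gaussMat (n - 1) m)
      ≤ ∫ z, G z ∂(gaussMat (n - 1) m) :=
        integral_mono_of_nonneg (Eventually.of_forall fun _ => abs_nonneg _) hGint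
          (Eventually.of_forall hle)
    _ = K * ((n - 1 : ℕ) : ℝ) ^ 2 * ∑ i : Fin (n - 1), ∑ j : Fin (n - 1), (n : ℝ)⁻¹ *
          ∑ μ : Fin m, ∑ ν : Fin m, L * (B * (2 * ∫ x, h x ∂stdGauss)) := by
        rw [hG, integral_const_mul, integral_finsetSum _ fun i _ => hj i]
        congr 1
        refine Finset.sum_congr rfl fun i _ => ?_
        rw [integral_finsetSum _ fun j _ => hμ i j]
        refine Finset.sum_congr rfl fun j _ => ?_
        rw [integral_const_mul, integral_finsetSum _ fun μ _ => hν i j μ]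
        congr 1
        refine Finset.sum_congr rfl fun μ _ => ?_
        rw [integral_finsetSum _ fun ν _ => hterm i j μ ν]
        refine Finset.sum_congr rfl fun ν _ => ?_
        rw [integral_const_mul, integral_const_mul,
          integral_add (integrable_gaussMat_entry i μ hInt) (integrable_gaussMat_entry j ν hInt),
          integral_gaussMat_entry i μ hInt, integral_gaussMat_entry j ν hInt, two_mul]
    _ ≤ K * ((n - 1 : ℕ) : ℝ) ^ 2 * ∑ _i : Fin (n - 1), ∑ _j : Fin (n - 1), (n : ℝ)⁻¹ *
          ∑ _μ : Fin m, ∑ _ν : Fin m, L * (B * (2 * I)) := by gcongr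
    _ = _ := by
        simp only [Finset.sum_const, Finset.card_univ, Fintype.card_fin, nsmul_eq_mul]
        ring

/-- A stretched exponential absorbs any fixed power. -/
theorem exists_pow_le_exp_rpow (p : ℕ) {b γ : ℝ} (hb : 0 < b) (hγ : 0 < γ) :
    ∃ P > (0 : ℝ), ∀ x : ℝ, 1 ≤ x → x ^ p ≤ P * Real.exp (b * x ^ γ) := by
  obtain ⟨k, hk⟩ := exists_nat_ge (p / γ)
  refine ⟨b⁻¹ ^ k * k.factorial, by positivity, fun x hx => ?_⟩
  have hx0 : 0 < x := by linarith
  have h1 : x ^ p ≤ (x ^ γ) ^ k := by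
    rw [← Real.rpow_natCast x p, ← Real.rpow_natCast (x ^ γ) k, ← Real.rpow_mul hx0.le]
    refine Real.rpow_le_rpow_of_exponent_le hx ?_
    rwa [div_le_iff₀ hγ, mul_comm] at hk
  have h2 := Real.pow_div_factorial_le_exp (x := b * x ^ γ) (by positivity) k
  rw [div_le_iff₀ (by positivity)] at h2
  calc x ^ p ≤ (x ^ γ) ^ k := h1
    _ = b⁻¹ ^ k * (b * x ^ γ) ^ k := by rw [← mul_pow, inv_mul_cancel_left₀ hb.ne']
    _ ≤ b⁻¹ ^ k * (Real.exp (b * x ^ γ) * k.factorial) := by gcongr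
    _ = _ := by ring

theorem truncation_lipschitz_lss
    (φ : ℝ → ℝ) (hφ : ContDiff ℝ 3 φ)
    (hbd : ∃ K : ℝ, ∀ x : ℝ, |x * deriv φ x| ≤ K ∧ |deriv (deriv φ) x| ≤ K)
    (α : ℝ) (hα : 1 < α)
    (m : ℕ → ℕ) (hm : Tendsto (fun n => (m n : ℝ) / n) atTop (𝓝 α))
    (γ : ℝ) (hγ : γ ∈ Ioo (0 : ℝ) (1 / 2)) :
    ∃ C₁ > (0 : ℝ), ∃ C₂ > (0 : ℝ),
      ∀ (n : ℕ) (y : Fin (m n) → ℝ) (K : ℝ≥0) (f : ℝ → ℝ), LipschitzWith K f →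
        (∫ z, |trF f (Hmat φ n y z) -
            trF f (Hmat φ n y (fun i μ => trunc ((n : ℝ) ^ (γ / 2)) (z i μ)))|
          ∂(gaussMat (n - 1) (m n)))
        ≤ C₁ * K * (n : ℝ) ^ ((3 : ℝ) / 2) * Real.exp (-C₂ * (n : ℝ) ^ γ) := by
  obtain ⟨D, hD⟩ := hbd
  have hD0 : 0 ≤ D := (abs_nonneg _).trans (hD 0).2
  obtain ⟨S, hS⟩ := hm.bddAbove_range
  obtain ⟨R, hR⟩ := (hm.inv₀ (by linarith)).bddAbove_range
  replace hS : ∀ n : ℕ, (m n : ℝ) / n ≤ S := fun n => hS ⟨n, rfl⟩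
  replace hR : ∀ n : ℕ, (n : ℝ) / m n ≤ R := fun n => by
    simpa using hR ⟨n, rfl⟩
  have hS0 : 0 ≤ S := le_trans (by positivity) (hS 0)
  have hR0 : 0 ≤ R := le_trans (by positivity) (hR 0)
  obtain ⟨M, hM, a, ha, htail⟩ := exists_one_sub_truncNorm_le
  obtain ⟨P, hP, hpow⟩ := exists_pow_le_exp_rpow 7 (b := a / 4) (by positivity) hγ.1
  set B := 1 + (Real.sqrt (truncNorm 1))⁻¹ with hB
  have hB0 : 0 ≤ B := by positivity
  set Q := S ^ 3 * (4 * R * D) * B * (2 * (1 + 2 * M)) with hQ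
  have hQ0 : 0 ≤ Q := by positivity
  refine ⟨(Q + 1) * P, by positivity, a / 4, by positivity, fun n y K f hf => ?_⟩
  rcases Nat.eq_zero_or_pos n with rfl | hn
  · have h0 : ∀ A : Matrix (Fin (0 - 1)) (Fin (0 - 1)) ℝ, trF f A = 0 := fun A =>
      Finset.sum_eq_zero fun i _ => i.elim0
    simp only [h0, sub_zero, abs_zero, integral_zero]
    positivity
  have hn1 : (1 : ℝ) ≤ n := by exact_mod_cast hn
  have hn0 : (0 : ℝ) < n := by linarith
  set N := (n : ℝ) ^ γ with hN
  have hc : 1 ≤ (n : ℝ) ^ (γ / 2) := Real.one_le_rpow hn1 (by linarith [hγ.1])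
  have hcN : ((n : ℝ) ^ (γ / 2)) ^ 2 = N := by
    rw [← Real.rpow_natCast, ← Real.rpow_mul hn0.le, hN]
    norm_num
  set ε := Real.exp (-(a / 2) * N) with hε
  have hε0 : 0 < ε := Real.exp_pos _
  have hεsq : Real.exp (-a * N) = ε * ε := by rw [hε, ← Real.exp_add]; ring_nf
  have hI : ε + ε⁻¹ * ∫ x, (x - trunc ((n : ℝ) ^ (γ / 2)) x) ^ 2 ∂stdGauss
      ≤ (1 + 2 * M) * ε := by
    have h1 := integral_sub_trunc_sq_le hc
    have h2 := htail _ (zero_le_one.trans hc)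
    rw [hcN, hεsq] at h2
    calc ε + ε⁻¹ * ∫ x, (x - trunc ((n : ℝ) ^ (γ / 2)) x) ^ 2 ∂stdGauss
        ≤ ε + ε⁻¹ * (2 * (M * (ε * ε))) := by gcongr; linarith
      _ = _ := by field_simp
  have hmS : (m n : ℝ) ≤ S * n := (div_le_iff₀ hn0).1 (hS n)
  have hkn : ((n - 1 : ℕ) : ℝ) ≤ n := by exact_mod_cast Nat.sub_le n 1
  refine (integral_abs_trF_sub_trunc_le φ y (by positivity)
    (abs_Lam_le φ n y (hR n) fun x => (hD x).2) hc hε0 hI hf).trans ?_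
  have hexp : Real.exp (a / 4 * N) * ε = Real.exp (-(a / 4) * N) := by
    rw [hε, ← Real.exp_add]; ring_nf
  have hroot : 1 ≤ (n : ℝ) ^ ((3 : ℝ) / 2) := Real.one_le_rpow hn1 (by norm_num)
  calc K * ((n - 1 : ℕ) : ℝ) ^ 4 * (n : ℝ)⁻¹ * (m n : ℝ) ^ 2 *
        (m n * (4 * R * D) * B * (2 * ((1 + 2 * M) * ε)))
      ≤ K * (n : ℝ) ^ 4 * 1 * (S * n) ^ 2 *
        ((S * n) * (4 * R * D) * B * (2 * ((1 + 2 * M) * ε))) := by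
        gcongr
        exact inv_le_one_of_one_le₀ hn1
    _ = K * Q * ((n : ℝ) ^ 7 * ε) := by rw [hQ]; ring
    _ ≤ K * (Q + 1) * (P * Real.exp (a / 4 * N) * ε) := by
        gcongr
        · linarith
        · exact hpow n hn1
    _ = (Q + 1) * P * K * 1 * Real.exp (-(a / 4) * N) := by rw [← hexp]; ring
    _ ≤ _ := by gcongr
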